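/- Let S be an F-finite regular ring of characteristic p > 0 such that F^e_* S is a free S-module, and let I ⊆ S be an ideal such that R = S/I admits an isomorphism Hom_R(F^e_* R, R) ≅ F^e_* R of F^e_* R-modules. Suppose (I^[p^e] : I) = I^[p^e] + (f_e) for some f_e ∈ S. Then for all n > 0, (I^[p^(ne)] : I) = I^[p^(ne)] + (f_e^(1 + p^e + p^(2e) + ⋯ + p^((n−1)e))). -/

import Mathlib

/-- The Frobenius (bracket) power `I^[q]`. -/
def frobPow {S : Type*} [CommRing S] (I : Ideal S) (q : ℕ) : Ideal S :=
  Ideal.span ((fun x => x ^ q) '' (I : Set S))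

/-- A family is Lech independent if every relation between its members has coefficients in the
ideal it generates. -/
def LechIndependent {ι L : Type*} [Fintype ι] [CommRing L] (v : ι → L) : Prop :=
  ∀ a : ι → L, ∑ i, a i * v i = 0 → ∀ i, a i ∈ Ideal.span (Set.range v)

namespace LechIndependent

theorem span_le_span_update {ι L : Type*} [DecidableEq ι] [CommRing L]
    {v : ι → L} {i : ι} {y z : L} (hi : v i = y * z) :
    Ideal.span (Set.range v) ≤ Ideal.span (Set.range (Function.update v i z)) := by
  rw [Ideal.span_le]
  rintro _ ⟨k, rfl⟩
  by_cases hk : k = i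
  · subst hk
    rw [hi]
    exact Ideal.mul_mem_left _ _ (Ideal.subset_span ⟨k, by simp⟩)
  · exact Ideal.subset_span ⟨k, by simp [hk]⟩

theorem mem_span_update {ι L : Type*} [Fintype ι] [DecidableEq ι] [CommRing L]
    {v : ι → L} (hv : LechIndependent v) {i : ι} {y z a : L}
    (hi : v i = y * z) (ha : y * a ∈ Ideal.span (Set.range v)) :
    a ∈ Ideal.span (Set.range (Function.update v i z)) := by
  obtain ⟨b, hb⟩ := Ideal.mem_span_range_iff_exists_fun.1 ha
  have key := hv (fun k => z * b k - if k = i then a else 0) (by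
    simp only [sub_mul, Finset.sum_sub_distrib, ite_mul, zero_mul, Finset.sum_ite_eq',
      Finset.mem_univ, if_true, mul_assoc, ← Finset.mul_sum, hb, hi]
    ring) i
  have h := span_le_span_update hi key
  simp only [if_true] at h
  have hz : z ∈ Ideal.span (Set.range (Function.update v i z)) :=
    Ideal.subset_span ⟨i, by simp⟩
  simpa using sub_mem (Ideal.mul_mem_right (b i) _ hz) h

theorem update {ι L : Type*} [Fintype ι] [DecidableEq ι] [CommRing L]
    {v : ι → L} (hv : LechIndependent v) {i : ι} {y z : L} (hi : v i = y * z) :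
    LechIndependent (Function.update v i z) := by
  intro a ha
  have key := hv (fun k => if k = i then a i else y * a k) (by
    rw [← mul_zero y, ← ha, Finset.mul_sum]
    refine Finset.sum_congr rfl fun k _ => ?_
    by_cases hk : k = i
    · subst hk
      simp only [if_true, hi, Function.update_self]
      ring
    · simp only [hk, if_false, Function.update_of_ne, ne_eq, not_false_eq_true]
      ring)
  intro k
  by_cases hk : k = i
  · subst hk
    simpa using span_le_span_update hi (key k)
  · exact hv.mem_span_update hi (by simpa [hk] using key k)

theorem update_piecewise_pow {ι L : Type*} [DecidableEq ι] [CommRing L]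
    (x : ι → L) (q : ℕ) (s : Finset ι) (i : ι) :
    Function.update (s.piecewise x fun k => x k ^ q) i (x i) =
      (insert i s).piecewise x fun k => x k ^ q :=
  (Finset.piecewise_insert s x (fun k => x k ^ q) i).symm

/-- Powers can be lowered to first powers on any set of indices. -/
theorem piecewise_pow {ι L : Type*} [Fintype ι] [DecidableEq ι] [CommRing L]
    {x : ι → L} {n : ℕ} (hx : LechIndependent fun k => x k ^ (n + 1))
    (s : Finset ι) : LechIndependent (s.piecewise x fun k => x k ^ (n + 1)) := by
  induction s using Finset.induction_on with
  | empty => simpa using hx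
  | insert i s hi ih =>
    rw [← update_piecewise_pow]
    exact ih.update (y := x i ^ n) (by simp [hi, pow_succ])

theorem mem_span_piecewise_pow {ι L : Type*} [Fintype ι] [DecidableEq ι] [CommRing L]
    {x : ι → L} {n : ℕ} (hx : LechIndependent fun k => x k ^ (n + 1))
    (s : Finset ι) {w : L}
    (hw : (∏ i ∈ s, x i ^ n) * w ∈ Ideal.span (Set.range fun k => x k ^ (n + 1))) :
    w ∈ Ideal.span (Set.range (s.piecewise x fun k => x k ^ (n + 1))) := by
  induction s using Finset.induction_on generalizing w with
  | empty => simpa using hw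
  | insert i s hi ih =>
    rw [← update_piecewise_pow]
    refine (hx.piecewise_pow s).mem_span_update (y := x i ^ n) (by simp [hi, pow_succ]) (ih ?_)
    rw [Finset.prod_insert hi] at hw
    convert hw using 1
    ring

theorem prod_pow_mul_piecewise_mem {ι L : Type*} [DecidableEq ι] [CommRing L]
    (x : ι → L) (n : ℕ) (s : Finset ι) (k : ι) :
    (∏ i ∈ s, x i ^ n) * s.piecewise x (fun k => x k ^ (n + 1)) k ∈
      Ideal.span (Set.range fun k => x k ^ (n + 1)) := by
  by_cases hk : k ∈ s
  · rw [← Finset.mul_prod_erase s _ hk, Finset.piecewise_eq_of_mem _ _ _ hk]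
    refine Ideal.mem_of_dvd _ ⟨∏ i ∈ s.erase k, x i ^ n, ?_⟩ (Ideal.subset_span ⟨k, rfl⟩)
    simp only
    ring
  · rw [Finset.piecewise_eq_of_notMem _ _ _ hk]
    exact Ideal.mul_mem_left _ _ (Ideal.subset_span ⟨k, rfl⟩)

theorem mem_sup_span_prod_pow {ι L : Type*} [Fintype ι] [DecidableEq ι] [CommRing L]
    {x : ι → L} {n : ℕ} (hx : LechIndependent fun k => x k ^ (n + 1))
    {z : L} (hz : ∀ i, x i * z ∈ Ideal.span (Set.range fun k => x k ^ (n + 1)))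
    (s : Finset ι) :
    z ∈ Ideal.span (Set.range fun k => x k ^ (n + 1)) ⊔ Ideal.span {∏ i ∈ s, x i ^ n} := by
  induction s using Finset.induction_on with
  | empty => simp
  | insert i s hi ih =>
    set Q := Ideal.span (Set.range fun k => x k ^ (n + 1)) with hQ
    obtain ⟨a, ha, b, hb, rfl⟩ := Submodule.mem_sup.1 ih
    obtain ⟨c, rfl⟩ := Ideal.mem_span_singleton'.1 hb
    refine add_mem (Ideal.mem_sup_left ha) ?_
    have h1 : (∏ i ∈ s, x i ^ n) * (x i * c) ∈ Q := by
      have := sub_mem (hz i) (Ideal.mul_mem_left _ (x i) ha)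
      convert this using 1
      ring
    have h2 := (hx.piecewise_pow s).mem_span_update (i := i) (y := x i) (z := x i ^ n)
      (by simp [hi, pow_succ']) (hx.mem_span_piecewise_pow s h1)
    obtain ⟨d, rfl⟩ := Ideal.mem_span_range_iff_exists_fun.1 h2
    rw [Finset.sum_mul]
    refine sum_mem fun k _ => ?_
    by_cases hk : k = i
    · subst hk
      refine Ideal.mem_sup_right (Ideal.mem_span_singleton'.2 ⟨d k, ?_⟩)
      rw [Finset.prod_insert hi, Function.update_self]
      ring
    · refine Ideal.mem_sup_left ?_
      rw [Function.update_of_ne hk]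
      have := Ideal.mul_mem_left _ (d k) (prod_pow_mul_piecewise_mem x n s k)
      rw [← hQ] at this
      convert this using 1
      ring

end LechIndependent

/-- A map is Cartier linear for a ring endomorphism `F` if it is additive and `F⁻¹`-linear, that
is, a linear map `F_* S → S`. -/
structure IsCartierLinear {S : Type*} [CommRing S] (F : S →+* S) (φ : S → S) : Prop where
  map_add : ∀ x y, φ (x + y) = φ x + φ y
  map_mul : ∀ r x, φ (F r * x) = r * φ x

namespace IsCartierLinear

variable {S : Type*} [CommRing S] {F : S →+* S} {φ : S → S}

theorem map_zero (hφ : IsCartierLinear F φ) : φ 0 = 0 := by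
  simpa using hφ.map_add 0 0

theorem map_sum (hφ : IsCartierLinear F φ) {ι : Type*} (s : Finset ι) (g : ι → S) :
    φ (∑ i ∈ s, g i) = ∑ i ∈ s, φ (g i) :=
  _root_.map_sum (AddMonoidHom.mk' φ hφ.map_add) g s

theorem mul_left (hφ : IsCartierLinear F φ) (u : S) : IsCartierLinear F fun x => φ (u * x) where
  map_add x y := by rw [mul_add, hφ.map_add]
  map_mul r x := by rw [mul_left_comm, hφ.map_mul]

theorem mem_of_mem_map (hφ : IsCartierLinear F φ) {J : Ideal S} {z : S} (hz : z ∈ J.map F) :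
    φ z ∈ J := by
  refine Submodule.span_induction (p := fun z _ => ∀ v, φ (v * z) ∈ J) ?_ ?_ ?_ ?_ hz 1
    |> fun h => by simpa using h
  · rintro _ ⟨a, ha, rfl⟩ v
    rw [mul_comm, hφ.map_mul]
    exact J.mul_mem_right _ ha
  · intro v
    simp [hφ.map_zero]
  · intro x y _ _ hx hy v
    rw [mul_add, hφ.map_add]
    exact add_mem (hx v) (hy v)
  · intro a x _ hx v
    rw [smul_eq_mul, ← mul_assoc]
    exact hx _

end IsCartierLinear

/-- A finite basis of `F_* S` over `S`. -/
structure PushforwardBasis {S : Type*} [CommRing S] (F : S →+* S) (m : ℕ) where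
  /-- The basis vectors. -/
  vec : Fin m → S
  /-- The coordinate functions. -/
  coord : Fin m → S → S
  isCartierLinear : ∀ i, IsCartierLinear F (coord i)
  sum_coord : ∀ x, ∑ i, F (coord i x) * vec i = x
  coord_sum : ∀ (a : Fin m → S) (i : Fin m), coord i (∑ j, F (a j) * vec j) = a i

namespace PushforwardBasis

variable {S : Type*} [CommRing S] {F : S →+* S} {m : ℕ}

theorem nonempty_of_existsUnique (b : Fin m → S)
    (hb : ∀ x : S, ∃! c : Fin m → S, x = ∑ i, F (c i) * b i) :
    Nonempty (PushforwardBasis F m) := by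
  choose c hc huniq using hb
  refine ⟨⟨b, fun i x => c x i, fun i => ⟨fun x y => ?_, fun r x => ?_⟩, fun x => (hc x).symm,
    fun a i => (congrFun (huniq _ a rfl) i).symm⟩⟩
  · refine (congrFun (huniq (x + y) (c x + c y) ?_) i).symm
    simp only [Pi.add_apply, map_add, add_mul, Finset.sum_add_distrib]
    rw [← hc x, ← hc y]
  · refine (congrFun (huniq (F r * x) (fun j => r * c x j) ?_) i).symm
    simp only [map_mul, mul_assoc, ← Finset.mul_sum]
    rw [← hc x]

theorem mem_map_iff (B : PushforwardBasis F m)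
    {J : Ideal S} {z : S} : z ∈ J.map F ↔ ∀ i, B.coord i z ∈ J := by
  refine ⟨fun hz i => (B.isCartierLinear i).mem_of_mem_map hz, fun h => ?_⟩
  rw [← B.sum_coord z]
  exact sum_mem fun i _ => Ideal.mul_mem_right _ _ (Ideal.mem_map_of_mem F (h i))

theorem mem_map_of_forall_isCartierLinear (B : PushforwardBasis F m) {J : Ideal S} {z : S}
    (h : ∀ φ, IsCartierLinear F φ → φ z ∈ J) : z ∈ J.map F :=
  B.mem_map_iff.2 fun i => h _ (B.isCartierLinear i)

theorem apply_eq_sum (B : PushforwardBasis F m) {φ : S → S} (hφ : IsCartierLinear F φ) (z : S) :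
    φ z = ∑ i, B.coord i z * φ (B.vec i) := by
  conv_lhs => rw [← B.sum_coord z, hφ.map_sum]
  simp only [hφ.map_mul]

/-- Pushing forward along `F` commutes with colons. -/
theorem mem_map_colon (B : PushforwardBasis F m)
    {J : Ideal S} {A : Set S} {z : S} (h : ∀ a ∈ A, z * F a ∈ J.map F) :
    z ∈ (J.colon A).map F := by
  refine B.mem_map_iff.2 fun i => Submodule.mem_colon.2 fun a ha => ?_
  have := B.mem_map_iff.1 (h a ha) i
  rwa [mul_comm, (B.isCartierLinear i).map_mul, mul_comm] at this

/-- A Cartier linear map whose pairing is nondegenerate modulo a maximal ideal `P` generates all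
Cartier linear maps away from `P`. -/
theorem exists_notMem_forall_mul_eq (B : PushforwardBasis F m)
    {P : Ideal S} [hP : P.IsMaximal] {T : S → S}
    (hT : IsCartierLinear F T) (hnd : ∀ u, (∀ v, T (u * v) ∈ P) → u ∈ P.map F) :
    ∃ s ∉ P, ∀ φ, IsCartierLinear F φ → ∃ u, ∀ v, s * φ v = T (u * v) := by
  let ev : S →+ (Fin m → S) :=
    { toFun := fun u j => T (u * B.vec j)
      map_zero' := by ext j; simp [hT.map_zero]
      map_add' := fun x y => by ext j; simp [add_mul, hT.map_add] }
  let N : Submodule S (Fin m → S) :=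
    { ev.range.toAddSubmonoid with
      smul_mem' := by
        rintro r _ ⟨u, rfl⟩
        exact ⟨F r * u, by ext j; simp [ev, mul_assoc, hT.map_mul]⟩ }
  have hN : ∀ {g}, g ∈ N → ∃ u, ∀ j, T (u * B.vec j) = g j := by
    rintro _ ⟨u, rfl⟩
    exact ⟨u, fun j => rfl⟩
  have hN' : ∀ u, (fun j => T (u * B.vec j)) ∈ N := fun u => ⟨u, rfl⟩
  let := Ideal.Quotient.field P
  let M : Matrix (Fin m) (Fin m) (S ⧸ P) :=
    fun i j => Ideal.Quotient.mk P (T (B.vec i * B.vec j))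
  have hM : ∀ (a : Fin m → S) (j : Fin m),
      Matrix.vecMul (fun i => Ideal.Quotient.mk P (a i)) M j =
        Ideal.Quotient.mk P (T ((∑ i, F (a i) * B.vec i) * B.vec j)) := by
    intro a j
    simp only [Matrix.vecMul, dotProduct, M, Finset.sum_mul, hT.map_sum, mul_assoc, hT.map_mul,
      _root_.map_sum, _root_.map_mul]
  have hinj : Function.Injective M.vecMulLinear := by
    refine (injective_iff_map_eq_zero _).2 fun a ha => ?_
    obtain ⟨a, rfl⟩ : ∃ a' : Fin m → S, (fun i => Ideal.Quotient.mk P (a' i)) = a :=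
      ⟨fun i => (a i).out, by ext i; simp⟩
    have hmem : ∑ i, F (a i) * B.vec i ∈ P.map F := by
      refine hnd _ fun v => ?_
      rw [B.apply_eq_sum (hT.mul_left _) v]
      refine sum_mem fun j _ => P.mul_mem_left _ (Ideal.Quotient.eq_zero_iff_mem.1 ?_)
      rw [← hM]
      exact congrFun ha j
    ext i
    have := B.mem_map_iff.1 hmem i
    rw [B.coord_sum] at this
    exact Ideal.Quotient.eq_zero_iff_mem.2 this
  have hsurj := LinearMap.injective_iff_surjective.1 hinj
  have hle : (⊤ : Submodule S (Fin m → S)) ≤ N ⊔ P • ⊤ := by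
    intro g _
    obtain ⟨a, ha⟩ := hsurj fun j => Ideal.Quotient.mk P (g j)
    obtain ⟨a, rfl⟩ : ∃ a' : Fin m → S, (fun i => Ideal.Quotient.mk P (a' i)) = a :=
      ⟨fun i => (a i).out, by ext i; simp⟩
    set u := ∑ i, F (a i) * B.vec i with hu
    have hdiff : ∀ j, g j - T (u * B.vec j) ∈ P := by
      intro j
      rw [← Ideal.Quotient.eq_zero_iff_mem, map_sub, sub_eq_zero, hu, ← hM]
      exact (congrFun ha j).symm
    refine Submodule.mem_sup.2 ⟨_, hN' u, fun j => g j - T (u * B.vec j), ?_, by ext j; simp⟩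
    rw [← Finset.univ_sum_single (fun j => g j - T (u * B.vec j))]
    refine sum_mem fun j _ => ?_
    have : Pi.single (M := fun _ => S) j (g j - T (u * B.vec j)) =
        (g j - T (u * B.vec j)) • Pi.single j 1 := by
      rw [← Pi.single_smul, smul_eq_mul, mul_one]
    rw [this]
    exact Submodule.smul_mem_smul (hdiff j) trivial
  obtain ⟨s, hs1, hs⟩ := Submodule.exists_sub_one_mem_and_smul_le_of_fg_of_le_sup
    (Module.Finite.fg_top (R := S) (M := Fin m → S)) le_top hle
  refine ⟨s, fun hsP => hP.ne_top ((Ideal.eq_top_iff_one P).2 ?_), fun φ hφ => ?_⟩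
  · simpa using sub_mem hsP hs1
  · obtain ⟨u, hu⟩ := hN (hs (Submodule.smul_mem_pointwise_smul (fun j => φ (B.vec j)) s ⊤ trivial))
    refine ⟨u, fun v => ?_⟩
    rw [B.apply_eq_sum hφ, B.apply_eq_sum (hT.mul_left u), Finset.mul_sum]
    refine Finset.sum_congr rfl fun j _ => ?_
    rw [hu j, Pi.smul_apply, smul_eq_mul]
    ring

/-- If every maximal ideal carries a nondegenerate Cartier linear map, then a Cartier linear map
preserving `I` kills, modulo `I`, whatever annihilates `(I.map F : I)` modulo `I.map F`. -/
theorem apply_mem_of_mul_colon_le (B : PushforwardBasis F m)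
    (hnd : ∀ P : Ideal S, P.IsMaximal → ∃ T, IsCartierLinear F T ∧
      ∀ u, (∀ v, T (u * v) ∈ P) → u ∈ P.map F)
    {I : Ideal S} {φ : S → S} (hφ : IsCartierLinear F φ) (hφI : ∀ x ∈ I, φ x ∈ I) {y : S}
    (hy : ∀ u ∈ (I.map F).colon (I : Set S), y * u ∈ I.map F) : φ y ∈ I := by
  by_contra hcon
  have hne : I.colon {φ y} ≠ ⊤ := fun h => hcon (by
    have : (1 : S) ∈ I.colon {φ y} := h ▸ trivial
    simpa using this)
  obtain ⟨P, hP, hle⟩ := Ideal.exists_le_maximal _ hne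
  obtain ⟨T, hT, hTnd⟩ := hnd P hP
  obtain ⟨s, hs, hgen⟩ := B.exists_notMem_forall_mul_eq hT hTnd
  obtain ⟨u, hu⟩ := hgen φ hφ
  have hcolon : F s * u ∈ (I.map F).colon (I : Set S) := by
    refine Submodule.mem_colon.2 fun a ha => B.mem_map_of_forall_isCartierLinear fun ψ hψ => ?_
    obtain ⟨w, hw⟩ := hgen ψ hψ
    rw [smul_eq_mul, mul_assoc, hψ.map_mul, hw, mul_left_comm, ← hu]
    exact I.mul_mem_left _ (hφI _ (I.mul_mem_left _ ha))
  have hmem : s * s * φ y ∈ I := by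
    have := hT.mem_of_mem_map (hy _ hcolon)
    rwa [mul_left_comm, hT.map_mul, mul_comm y u, ← hu, ← mul_assoc] at this
  have hss : s * s ∈ P := hle (Submodule.mem_colon_singleton.2 hmem)
  exact (hP.isPrime.mem_or_mem hss).elim hs hs

end PushforwardBasis

theorem Ideal.IsMaximal.mem_of_mul_mem {S : Type*} [CommRing S] {P Q : Ideal S}
    (hP : P.IsMaximal) {c z : S} (hc : c ∉ P) (hz : ∀ a ∈ P, a * z ∈ Q) (hcz : c * z ∈ Q) :
    z ∈ Q := by
  obtain ⟨d, a, ha, h⟩ := hP.exists_inv hc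
  have : z = d * (c * z) + a * z := by linear_combination (-z) * h
  rw [this]
  exact add_mem (Q.mul_mem_left _ hcz) (hz a ha)

/-- A maximal ideal of a Noetherian ring is generated, away from itself, by finitely many elements
all of whose relations have coefficients in the ideal. -/
theorem Ideal.IsMaximal.exists_minimal_generators {S : Type*} [CommRing S] [IsNoetherianRing S]
    {P : Ideal S} (hP : P.IsMaximal) :
    ∃ t : Finset S, (t : Set S) ⊆ P ∧ (∃ r ∉ P, ∀ a ∈ P, r * a ∈ Ideal.span (t : Set S)) ∧
      ∀ a : t → S, ∑ i, a i * (i : S) = 0 → ∀ i, a i ∈ P := by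
  classical
  have hex : ∃ k : ℕ, ∃ t : Finset S, t.card = k ∧ (t : Set S) ⊆ P ∧
      P ≤ Ideal.span (t : Set S) ⊔ P • P := by
    obtain ⟨t, ht⟩ := IsNoetherian.noetherian P
    exact ⟨_, t, rfl, ht ▸ Submodule.subset_span, ht.ge.trans le_sup_left⟩
  obtain ⟨t, hcard, htP, hle⟩ := Nat.find_spec hex
  refine ⟨t, htP, ?_, fun a ha i => ?_⟩
  · obtain ⟨r, hr1, hr⟩ := Submodule.exists_sub_one_mem_and_smul_le_of_fg_of_le_sup
      (IsNoetherian.noetherian P) le_rfl hle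
    refine ⟨r, fun hrP => hP.ne_top ((Ideal.eq_top_iff_one P).2 ?_), fun a ha => ?_⟩
    · simpa using sub_mem hrP hr1
    · exact hr (Submodule.smul_mem_pointwise_smul a r P ha)
  · by_contra hai
    refine Nat.find_min hex (m := (t.erase i).card)
      (hcard ▸ Finset.card_erase_lt_of_mem i.2) ⟨t.erase i, rfl, ?_, ?_⟩
    · exact fun x hx => htP (Finset.mem_of_mem_erase hx)
    · refine hle.trans (sup_le (Ideal.span_le.2 fun x hx => ?_) le_sup_right)
      by_cases hxi : x = i
      · subst hxi
        refine hP.mem_of_mul_mem hai (fun b hb => ?_) ?_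
        · exact Ideal.mem_sup_right (Submodule.smul_mem_smul hb (htP hx))
        · rw [← Finset.add_sum_erase _ _ (Finset.mem_univ i)] at ha
          rw [eq_neg_of_add_eq_zero_left ha]
          refine neg_mem (_root_.sum_mem fun k hk => Ideal.mem_sup_left (Ideal.mul_mem_left _ _ ?_))
          refine Ideal.subset_span (Finset.mem_erase.2 ⟨fun h => ?_, k.2⟩)
          exact Finset.ne_of_mem_erase hk (Subtype.ext h)
      · exact Ideal.mem_sup_left (Ideal.subset_span (Finset.mem_erase.2 ⟨hxi, hx⟩))

namespace PushforwardBasis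

variable {S : Type*} [CommRing S] {F : S →+* S} {m : ℕ}

/-- The fibre of Frobenius over a maximal ideal has principal socle. -/
theorem exists_colon_map_le (B : PushforwardBasis F m)
    [IsNoetherianRing S] {n : ℕ} (hF : ∀ x, F x = x ^ (n + 1))
    {P : Ideal S} (hP : P.IsMaximal) :
    ∃ w, (∀ a ∈ P, a * w ∈ P.map F) ∧
      ∀ z, (∀ a ∈ P, a * z ∈ P.map F) → z ∈ P.map F ⊔ Ideal.span {w} := by
  classical
  have := hP.isPrime
  obtain ⟨t, htP, ⟨r, hrP, hr⟩, hrel⟩ := hP.exists_minimal_generators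
  let L := Localization.AtPrime P
  let g : S →+* L := algebraMap S L
  let x : t → L := fun i => g i
  have hunit : ∀ s ∉ P, IsUnit (g s) := fun s hs =>
    IsLocalization.map_units L (⟨s, hs⟩ : P.primeCompl)
  have hpow : ∀ i : t, (i : S) ^ (n + 1) ∈ P.map F := fun i =>
    hF i ▸ Ideal.mem_map_of_mem F (htP i.2)
  have hspan_le : Ideal.span (Set.range fun i => x i ^ (n + 1)) ≤ (P.map F).map g := by
    rw [Ideal.span_le]
    rintro _ ⟨i, rfl⟩
    simpa [x] using Ideal.mem_map_of_mem g (hpow i)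
  have hle_span : (P.map F).map g ≤ Ideal.span (Set.range fun i => x i ^ (n + 1)) := by
    rw [Ideal.map_le_iff_le_comap, Ideal.map_le_iff_le_comap]
    intro a ha
    have hmem : F (r * a) ∈ Ideal.comap g (Ideal.span (Set.range fun i => x i ^ (n + 1))) := by
      have h1 : F (r * a) ∈ (Ideal.span (t : Set S)).map F := Ideal.mem_map_of_mem F (hr a ha)
      rw [Ideal.map_span] at h1
      refine Ideal.span_le.2 ?_ h1
      rintro _ ⟨b, hb, rfl⟩
      refine Ideal.subset_span ⟨⟨b, hb⟩, ?_⟩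
      simp [x, hF]
    rw [Ideal.mem_comap, map_mul, map_mul, hF r, map_pow] at hmem
    exact (Ideal.unit_mul_mem_iff_mem _ ((hunit r hrP).pow _)).1 hmem
  have hind : LechIndependent fun i => x i ^ (n + 1) := by
    intro a ha
    obtain ⟨d, hd⟩ := IsLocalization.exist_integer_multiples_of_finite P.primeCompl a
    choose α hα using hd
    have hα' : ∀ i, g (α i) = g d * a i := fun i => by
      rw [show g (α i) = _ from hα i, Algebra.smul_def]
    have hzero : g (∑ i, α i * (i : S) ^ (n + 1)) = 0 := by
      simp only [map_sum, map_mul, map_pow, hα', mul_assoc, ← Finset.mul_sum]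
      rw [show ∑ i, a i * g i ^ (n + 1) = 0 from ha, mul_zero]
    obtain ⟨c, hc⟩ := (IsLocalization.map_eq_zero_iff P.primeCompl L _).1 hzero
    have hmem : ∀ i, (c : S) * α i ∈ P.map F := by
      intro i
      refine B.mem_map_iff.2 fun j => hrel (fun i => B.coord j (c * α i)) ?_ i
      rw [← (B.isCartierLinear j).map_zero, ← hc, Finset.mul_sum, (B.isCartierLinear j).map_sum]
      refine Finset.sum_congr rfl fun i _ => ?_
      rw [← hF, ← mul_assoc, mul_comm _ (F _), (B.isCartierLinear j).map_mul, mul_comm]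
    intro i
    have := hle_span (Ideal.mem_map_of_mem g (hmem i))
    rw [map_mul, hα', ← mul_assoc] at this
    exact (Ideal.unit_mul_mem_iff_mem _ ((hunit c c.2).mul (hunit d d.2))).1 this
  let w₀ : S := ∏ i : t, (i : S) ^ n
  have hw₀ : ∀ i : t, (i : S) * w₀ ∈ P.map F := by
    intro i
    simp only [w₀]
    rw [← Finset.mul_prod_erase _ _ (Finset.mem_univ i), ← mul_assoc, ← pow_succ']
    exact Ideal.mul_mem_right _ _ (hpow i)
  have hwP : ∀ a ∈ P, a * (r * w₀) ∈ P.map F := by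
    intro a ha
    have h : Ideal.span (t : Set S) ≤ (P.map F).colon {w₀} := Ideal.span_le.2 fun i hi =>
      Submodule.mem_colon_singleton.2 (hw₀ ⟨i, hi⟩)
    have := Submodule.mem_colon_singleton.1 (h (hr a ha))
    rwa [smul_eq_mul, mul_comm r, mul_assoc] at this
  refine ⟨r * w₀, hwP, fun z hz => ?_⟩
  have hzL := hind.mem_sup_span_prod_pow (z := g z) (fun i => hle_span (by
    simpa [x] using Ideal.mem_map_of_mem g (hz i (htP i.2)))) Finset.univ
  have hzL' : g z ∈ (P.map F ⊔ Ideal.span {w₀}).map g := by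
    rw [Ideal.map_sup, Ideal.map_span, Set.image_singleton]
    refine sup_le_sup_right hspan_le _ ?_
    simpa [w₀, x] using hzL
  obtain ⟨c, hc, hcz⟩ :=
    (IsLocalization.algebraMap_mem_map_algebraMap_iff P.primeCompl L _ z).1 hzL'
  have hrc : r * c ∉ P := fun h => (hP.isPrime.mem_or_mem h).elim hrP hc
  refine hP.mem_of_mul_mem hrc (fun a ha => Ideal.mem_sup_left (hz a ha)) ?_
  obtain ⟨a, ha, b, hb, hab⟩ := Submodule.mem_sup.1 hcz
  obtain ⟨d, rfl⟩ := Ideal.mem_span_singleton'.1 hb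
  refine Submodule.mem_sup.2 ⟨r * a, Ideal.mul_mem_left _ _ ha, d * (r * w₀),
    Ideal.mem_span_singleton'.2 ⟨d, rfl⟩, ?_⟩
  linear_combination r * hab

/-- Over every maximal ideal, Frobenius admits a nondegenerate Cartier linear map. -/
theorem exists_nondegenerate (B : PushforwardBasis F m)
    [IsNoetherianRing S] {n : ℕ} (hF : ∀ x, F x = x ^ (n + 1))
    {P : Ideal S} (hP : P.IsMaximal) :
    ∃ T, IsCartierLinear F T ∧ ∀ u, (∀ v, T (u * v) ∈ P) → u ∈ P.map F := by
  obtain ⟨w, hwP, hw⟩ := B.exists_colon_map_le hF hP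
  obtain ⟨k, hk⟩ : ∃ k, P ^ k ≤ P.map F := by
    refine Ideal.exists_pow_le_of_le_radical_of_fg (fun a ha => ⟨n + 1, ?_⟩)
      (IsNoetherian.noetherian P)
    exact hF a ▸ Ideal.mem_map_of_mem F ha
  have hsocle : ∀ (j : ℕ) (u : S), (∀ a ∈ P ^ j, a * u ∈ P.map F) → u ∉ P.map F →
      ∃ v, u * v ∉ P.map F ∧ ∀ a ∈ P, a * (u * v) ∈ P.map F := by
    intro j
    induction j with
    | zero =>
      intro u h hu
      exact absurd (by simpa using h 1 (by simp)) hu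
    | succ j ih =>
      intro u h hu
      by_cases hall : ∀ a ∈ P, a * u ∈ P.map F
      · exact ⟨1, by simpa using hu, by simpa using hall⟩
      · push Not at hall
        obtain ⟨b, hb, hbu⟩ := hall
        obtain ⟨v, hv, hv'⟩ := ih (b * u) (fun a ha => by
          rw [← mul_assoc]
          exact h _ (pow_succ P j ▸ Ideal.mul_mem_mul ha hb)) hbu
        have huv : u * (b * v) = b * u * v := by ring
        exact ⟨b * v, huv ▸ hv, huv ▸ hv'⟩
  have hdecomp : ∀ u ∉ P.map F, ∃ v c, u * v - c * w ∈ P.map F ∧ c * w ∉ P.map F := by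
    intro u hu
    obtain ⟨v, hv, hv'⟩ := hsocle k u (fun a ha => Ideal.mul_mem_right _ _ (hk ha)) hu
    obtain ⟨a, ha, b, hb, hab⟩ := Submodule.mem_sup.1 (hw _ hv')
    obtain ⟨c, rfl⟩ := Ideal.mem_span_singleton'.1 hb
    refine ⟨v, c, by rwa [← hab, add_sub_cancel_right], fun h => hv ?_⟩
    exact hab ▸ add_mem ha h
  have hone : (1 : S) ∉ P.map F := by
    have hle : P.map F ≤ P := Ideal.map_le_iff_le_comap.2 fun a ha => by
      rw [Ideal.mem_comap, hF]
      exact Ideal.pow_mem_of_mem _ ha _ n.succ_pos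
    exact fun h => hP.ne_top ((Ideal.eq_top_iff_one P).2 (hle h))
  obtain ⟨i, hi⟩ : ∃ i, B.coord i w ∉ P := by
    obtain ⟨v, c, -, hc⟩ := hdecomp 1 hone
    by_contra! h
    exact hc (Ideal.mul_mem_left _ _ (B.mem_map_iff.2 h))
  have hT := B.isCartierLinear i
  refine ⟨B.coord i, hT, fun u hu => ?_⟩
  by_contra huP
  obtain ⟨v, c, hmem, hc⟩ := hdecomp u huP
  have hcP : c ∉ P := fun h => hc (hwP c h)
  obtain ⟨d, a, ha, hda⟩ := hP.exists_inv hcP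
  have hsum : w = u * (v * d) + (a * w - d * (u * v - c * w)) := by
    linear_combination (-w) * hda
  apply hi
  rw [hsum, hT.map_add]
  exact add_mem (hu _) (hT.mem_of_mem_map (sub_mem (hwP a ha) (Ideal.mul_mem_left _ _ hmem)))

end PushforwardBasis

/-- The composition formula for an endomorphism `F` with a pushforward basis, granted that
`(I.map F : f) ⊆ I`. -/
theorem PushforwardBasis.colon_map_iterate {S : Type*} [CommRing S] {F : S →+* S} {m : ℕ}
    (B : PushforwardBasis F m) {I : Ideal S} {f : S}
    (hFI : ∀ a ∈ I, F a ∈ I)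
    (hf : (I.map F).colon (I : Set S) = I.map F ⊔ Ideal.span {f})
    (hfI : ∀ y, y * f ∈ I.map F → y ∈ I) (J : ℕ → Ideal S) (g : ℕ → S)
    (hJ₀ : J 0 = I) (hJ : ∀ n, J (n + 1) = (J n).map F)
    (hg₀ : g 0 = 1) (hg : ∀ n, g (n + 1) = f * F (g n)) (n : ℕ) :
    (J n).colon {g n} ≤ I ∧ (∀ a ∈ I, g n * a ∈ J n) ∧
      (J n).colon (I : Set S) ≤ J n ⊔ Ideal.span {g n} := by
  have hfmem : f ∈ (I.map F).colon (I : Set S) :=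
    hf ▸ Ideal.mem_sup_right (Ideal.mem_span_singleton_self f)
  induction n with
  | zero => exact ⟨fun x hx => by simpa [hJ₀, hg₀] using hx, by simp [hJ₀, hg₀], by simp [hg₀]⟩
  | succ n ih =>
    obtain ⟨hcol, hmem, hgen⟩ := ih
    have hcolF : ∀ y, y * F (g n) ∈ J (n + 1) → y ∈ I.map F := fun y hy =>
      Ideal.map_mono hcol (B.mem_map_colon (A := {g n}) (by
        rintro _ rfl
        rwa [← hJ]))
    have hmem' : ∀ a ∈ I.map F, F (g n) * a ∈ J (n + 1) := by
      intro a ha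
      have hle : I.map F ≤ (J (n + 1)).colon {F (g n)} := Ideal.map_le_iff_le_comap.2 fun b hb => by
        rw [Ideal.mem_comap, Submodule.mem_colon_singleton, smul_eq_mul, ← map_mul, mul_comm, hJ]
        exact Ideal.mem_map_of_mem F (hmem b hb)
      rw [mul_comm]
      exact Submodule.mem_colon_singleton.1 (hle ha)
    refine ⟨fun y hy => hfI y (hcolF _ ?_), fun a ha => ?_, fun z hz => ?_⟩
    · rw [Submodule.mem_colon_singleton, smul_eq_mul, hg] at hy
      rwa [mul_assoc]
    · rw [hg, mul_comm f, mul_assoc]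
      exact hmem' _ (Submodule.mem_colon.1 hfmem a ha)
    · have hdecomp : z ∈ J (n + 1) ⊔ Ideal.span {F (g n)} := by
        have hzF : z ∈ ((J n).colon (I : Set S)).map F := B.mem_map_colon fun a ha => by
          rw [← hJ]
          exact Submodule.mem_colon.1 hz _ (hFI a ha)
        have := Ideal.map_mono (f := F) hgen hzF
        rwa [Ideal.map_sup, Ideal.map_span, Set.image_singleton, ← hJ] at this
      obtain ⟨a, ha, b, hb, rfl⟩ := Submodule.mem_sup.1 hdecomp
      obtain ⟨c, rfl⟩ := Ideal.mem_span_singleton'.1 hb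
      have hc : c ∈ (I.map F).colon (I : Set S) := Submodule.mem_colon.2 fun x hx => hcolF _ (by
        have h1 := Submodule.mem_colon.1 hz x hx
        have h2 := sub_mem h1 (Ideal.mul_mem_right x _ ha)
        convert h2 using 1
        simp only [smul_eq_mul]
        ring)
      rw [hf] at hc
      obtain ⟨c₁, hc₁, c₂, hc₂, rfl⟩ := Submodule.mem_sup.1 hc
      obtain ⟨d, rfl⟩ := Ideal.mem_span_singleton'.1 hc₂
      refine Submodule.mem_sup.2 ⟨a + F (g n) * c₁, add_mem ha (hmem' _ hc₁), d * g (n + 1),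
        Ideal.mem_span_singleton'.2 ⟨d, rfl⟩, ?_⟩
      rw [hg]
      ring

/-- Fedder-type composition formula: if `S` is an `F`-finite regular ring with
`F^e_* S` free, `R = S/I` has `Hom_R(F^e_* R, R) ≅ F^e_* R` as `F^e_* R`-modules
(witnessed by a generating `p^{-e}`-linear map `Φ`), and
`(I^[p^e] : I) = I^[p^e] + (f)`, then
`(I^[p^{ne}] : I) = I^[p^{ne}] + (f^{1 + p^e + ⋯ + p^{(n-1)e}})` for all `n > 0`. -/
theorem stmt10 (S : Type*) [CommRing S] [IsNoetherianRing S]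
    (p : ℕ) (hp : p.Prime) [CharP S p] [ExpChar S p] (e : ℕ) (he : 0 < e)
    -- `S` is F-finite
    (hFfin : (frobenius S p).Finite)
    -- `S` is regular: at every prime, the maximal ideal of the localization is
    -- generated by (Krull dimension)-many elements
    (hreg : ∀ (P : Ideal S) [P.IsPrime],
      ∃ (n : ℕ) (g : Fin n → Localization.AtPrime P),
        IsLocalRing.maximalIdeal (Localization.AtPrime P) =
          Ideal.span (Set.range g) ∧
        ringKrullDim (Localization.AtPrime P) = (n : WithBot (WithTop ℕ)))
    -- `F^e_* S` is a free `S`-module: there is a `p^e`-basis of `S`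
    (hfree : ∃ (m : ℕ) (bb : Fin m → S), ∀ x : S,
      ∃! c : Fin m → S, x = ∑ i, (c i) ^ p ^ e * bb i)
    (I : Ideal S)
    -- `Hom_R(F^e_* R, R)` is a free rank-one `F^e_* R`-module for `R = S/I`,
    -- generated by a `p^{-e}`-linear map `Φ`
    (Φ : S ⧸ I → S ⧸ I)
    (hΦadd : ∀ x y, Φ (x + y) = Φ x + Φ y)
    (hΦsemi : ∀ r x, Φ (r ^ p ^ e * x) = r * Φ x)
    (hΦgen : ∀ ψ : S ⧸ I → S ⧸ I,
      (∀ x y, ψ (x + y) = ψ x + ψ y) → (∀ r x, ψ (r ^ p ^ e * x) = r * ψ x) →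
      ∃! s : S ⧸ I, ∀ x, ψ x = Φ (s * x))
    (f : S)
    (hf : (frobPow I (p ^ e)).colon I = frobPow I (p ^ e) ⊔ Ideal.span {f}) :
    ∀ n > 0, (frobPow I (p ^ (n * e))).colon I =
      frobPow I (p ^ (n * e)) ⊔
        Ideal.span {f ^ (∑ i ∈ Finset.range n, p ^ (i * e))} := by
  have hq : 0 < p ^ e := pow_pos hp.pos e
  obtain ⟨k, hk⟩ := Nat.exists_eq_succ_of_ne_zero hq.ne'
  let F : S →+* S := iterateFrobenius S p e
  have hF : ∀ x, F x = x ^ p ^ e := fun x => rfl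
  obtain ⟨m, bb, hbb⟩ := hfree
  obtain ⟨B⟩ := PushforwardBasis.nonempty_of_existsUnique (F := F) bb hbb
  have hJ : ∀ j, frobPow I (p ^ j) = I.map (iterateFrobenius S p j) := fun j => rfl
  have hf' : (I.map F).colon (I : Set S) = I.map F ⊔ Ideal.span {f} := hf
  have hfI : ∀ y, y * f ∈ I.map F → y ∈ I := by
    intro y hy
    have hsurj := Ideal.Quotient.mk_surjective (I := I)
    choose d hd using fun i => hsurj (Φ (Ideal.Quotient.mk I (B.vec i)))
    have hφ : IsCartierLinear F fun x => ∑ i, B.coord i x * d i :=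
      ⟨fun x y => by
        simp only [(B.isCartierLinear _).map_add, add_mul, Finset.sum_add_distrib],
      fun r x => by
        simp only [(B.isCartierLinear _).map_mul, mul_assoc, Finset.mul_sum]⟩
    have hΦzero : Φ 0 = 0 := by simpa using hΦadd 0 0
    have hlift : ∀ x, Ideal.Quotient.mk I (∑ i, B.coord i x * d i) =
        Φ (Ideal.Quotient.mk I x) := by
      intro x
      conv_rhs => rw [← B.sum_coord x, map_sum]
      rw [map_sum, show Φ (∑ i, _) = ∑ i, Φ _ from
        map_sum (AddMonoidHom.mk' Φ hΦadd) _ _]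
      refine Finset.sum_congr rfl fun i _ => ?_
      rw [map_mul, hd, map_mul, hF, map_pow, hΦsemi]
    have hzero : ∀ x, Φ (Ideal.Quotient.mk I y * x) = 0 := by
      intro x
      obtain ⟨x, rfl⟩ := hsurj x
      rw [← map_mul, ← hlift, Ideal.Quotient.eq_zero_iff_mem]
      refine B.apply_mem_of_mul_colon_le
        (fun P hP => B.exists_nondegenerate (fun x => (hF x).trans (by rw [hk])) hP) hφ
        (fun a ha => ?_) (fun u hu => ?_)
      · rw [← Ideal.Quotient.eq_zero_iff_mem, hlift, Ideal.Quotient.eq_zero_iff_mem.2 ha, hΦzero]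
      · rw [hf'] at hu
        obtain ⟨a, ha, b, hb, rfl⟩ := Submodule.mem_sup.1 hu
        obtain ⟨c, rfl⟩ := Ideal.mem_span_singleton'.1 hb
        have := add_mem (Ideal.mul_mem_left _ (y * x) ha) (Ideal.mul_mem_left _ (x * c) hy)
        convert this using 1
        ring
    have huniq := (hΦgen (fun _ => 0) (by simp) (by simp)).unique
      (fun x => (hzero x).symm) (y₂ := 0) (fun x => by rw [zero_mul, hΦzero])
    exact Ideal.Quotient.eq_zero_iff_mem.1 huniq
  intro n _
  obtain ⟨-, hmem, hle⟩ := B.colon_map_iterate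
    (fun a ha => hF a ▸ Ideal.pow_mem_of_mem _ ha _ hq) hf' hfI
    (fun n => I.map (iterateFrobenius S p (n * e)))
    (fun n => f ^ ∑ i ∈ Finset.range n, p ^ (i * e))
    (by
      rw [zero_mul, iterateFrobenius_zero, Ideal.map_id])
    (fun n => by
      rw [Ideal.map_map, add_mul, one_mul, add_comm, iterateFrobenius_add])
    (by simp)
    (fun n => by
      rw [hF, ← pow_mul, ← pow_succ', Finset.sum_range_succ', zero_mul, pow_zero,
        Finset.sum_mul]
      simp only [add_mul, one_mul, pow_add]) n
  rw [hJ]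
  refine le_antisymm hle (sup_le ?_ ((Ideal.span_singleton_le_iff_mem _).2 ?_))
  · exact fun x hx => Submodule.mem_colon.2 fun a _ => Ideal.mul_mem_right a _ hx
  · exact Submodule.mem_colon.2 hmem
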